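/- Let C be a d-dimensional Archimedean copula with strict generator ψ. If μ_C is singular with respect to λ_d, then for every ℓ ∈ {1,…,d−2} there exists a set Λ ∈ B([0,1]^ℓ) with λ_ℓ(Λ) = 1 such that for every x ∈ Λ the conditional copula Cˣ is singular with respect to λ_{d−ℓ} (i.e. μ_{Cˣ} ⟂ λ_{d−ℓ}). -/

import Mathlib

open MeasureTheory ProbabilityTheory Set Filter Topology
open scoped ENNReal

noncomputable section
attribute [local instance] Classical.propDecidable

/-- The lower-orthant box `[0, y] = [0,y₁] × ⋯ × [0,y_k]` (as a lower set in `ℝ^k`;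
all measures considered are supported on the unit cube). -/
def lowerBox {k : ℕ} (y : Fin k → ℝ) : Set (Fin k → ℝ) := {t | ∀ i, t i ≤ y i}

/-- The closed unit cube `[0,1]^k`. -/
def unitCube (k : ℕ) : Set (Fin k → ℝ) := {t | ∀ i, t i ∈ Icc (0 : ℝ) 1}

/-- `η` is a `k`-monotone Archimedean generator with (real-valued) pseudoinverse `ξ`. -/
structure IsRealGenerator (k : ℕ) (η ξ : ℝ → ℝ) : Prop where
  continuousOn : ContinuousOn η (Ici 0)
  at_zero : η 0 = 1
  tendsto_zero : Tendsto η atTop (nhds 0)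
  nonneg : ∀ z : ℝ, 0 ≤ z → 0 ≤ η z
  antitoneOn : AntitoneOn η (Ici 0)
  strict_anti : ∀ z₁ z₂ : ℝ, 0 ≤ z₁ → z₁ < z₂ → 0 < η z₂ → η z₂ < η z₁
  smooth : ∀ z : ℝ, 0 < z → ContDiffAt ℝ ((k - 2 : ℕ) : ℕ∞) η z
  alt_sign : ∀ m : ℕ, m ≤ k - 2 → ∀ z : ℝ, 0 < z → 0 ≤ (-1 : ℝ) ^ m * iteratedDeriv m η z
  top_antitone : AntitoneOn (fun z => (-1 : ℝ) ^ (k - 2) * iteratedDeriv (k - 2) η z) (Ioi 0)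
  top_convex : ConvexOn ℝ (Ioi 0) (fun z => (-1 : ℝ) ^ (k - 2) * iteratedDeriv (k - 2) η z)
  xi_nonneg : ∀ t : ℝ, 0 < t → t ≤ 1 → 0 ≤ ξ t
  eta_xi : ∀ t : ℝ, 0 < t → t ≤ 1 → η (ξ t) = t

/-- `ψ` is a strict `d`-monotone Archimedean generator with pseudoinverse `φ`
(strictness: `φ(0) = ∞`, equivalently `ψ > 0` on `[0,∞)` and `φ ∘ ψ = id` there). -/
def IsStrictGenerator (d : ℕ) (ψ φ : ℝ → ℝ) : Prop :=
  IsRealGenerator d ψ φ ∧ (∀ z : ℝ, 0 ≤ z → 0 < ψ z) ∧ (∀ z : ℝ, 0 ≤ z → φ (ψ z) = z)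

/-- The pseudoinverse `ξ(t) = inf{z ≥ 0 : η(z) ≤ t}` of a generator `η`. -/
def pseudoInv (η : ℝ → ℝ) (t : ℝ) : ℝ := sInf {z | 0 ≤ z ∧ η z ≤ t}

/-- The conditional Archimedean generator
`ψˣ(z) = ψ^{(ℓ)}(Σᵢ φ(xᵢ) + z) / ψ^{(ℓ)}(Σᵢ φ(xᵢ))`. -/
def psiX (ψ φ : ℝ → ℝ) {l : ℕ} (x : Fin l → ℝ) (z : ℝ) : ℝ :=
  iteratedDeriv l ψ ((∑ i, φ (x i)) + z) / iteratedDeriv l ψ (∑ i, φ (x i))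

/-- The common univariate marginal `g_x(y) = K_C(x, [0,y] × [0,1]^{d-ℓ-1})`
of the conditional distribution `K_C(x,·)` of a strict Archimedean copula; explicitly
`g_x(y) = ψ^{(ℓ)}(Σᵢ φ(xᵢ) + φ(y)) / ψ^{(ℓ)}(Σᵢ φ(xᵢ))` for `y ∈ (0,1]` and
`g_x(y) = 0` for `y ≤ 0`. -/
def gxF (ψ φ : ℝ → ℝ) {l : ℕ} (x : Fin l → ℝ) (y : ℝ) : ℝ :=
  if y ≤ 0 then 0
  else iteratedDeriv l ψ ((∑ i, φ (x i)) + φ y) / iteratedDeriv l ψ (∑ i, φ (x i))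

/-- The `ℓ`-Markov kernel of a strict `d`-dimensional Archimedean copula on the box
`[0,y]`: `K_C(x,[0,y]) = ψ^{(ℓ)}(Σᵢ φ(xᵢ) + Σⱼ φ(yⱼ)) / ψ^{(ℓ)}(Σᵢ φ(xᵢ))`
(equal to `0` whenever some `yⱼ = 0`). -/
def archKR (ψ φ : ℝ → ℝ) {l k : ℕ} (x : Fin l → ℝ) (y : Fin k → ℝ) : ℝ :=
  if ∃ j, y j ≤ 0 then 0
  else iteratedDeriv l ψ ((∑ i, φ (x i)) + ∑ j, φ (y j)) / iteratedDeriv l ψ (∑ i, φ (x i))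

/-- The conditional copula `Cˣ` of a strict Archimedean copula:
`Cˣ(u) = ψˣ(Σⱼ (ψˣ)⁻¹(uⱼ))` where `ψˣ` is the conditional generator (with the
convention `Cˣ(u) = 0` if some coordinate of `u` is `0`). -/
def condCop (ψ φ : ℝ → ℝ) {l : ℕ} (x : Fin l → ℝ) {k : ℕ} (u : Fin k → ℝ) : ℝ :=
  if ∃ j, u j ≤ 0 then 0
  else psiX ψ φ x (∑ j, pseudoInv (psiX ψ φ x) (u j))

/-- The copula function of the Archimedean copula generated by `ψ`:
`C(x) = ψ(Σᵢ φ(xᵢ))` (with the convention `C(x) = 0` if some coordinate is `0`). -/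
def archCopF (ψ φ : ℝ → ℝ) {k : ℕ} (x : Fin k → ℝ) : ℝ :=
  if ∃ i, x i ≤ 0 then 0 else ψ (∑ i, φ (x i))

/-! ### Null sets under coordinatewise maps -/

lemma null_image_coord {k : ℕ} {f : ℝ → ℝ} {I : Set ℝ} (hf : LocallyLipschitzOn I f)
    {A : Set (Fin k → ℝ)} (hA : ∀ t ∈ A, ∀ i, t i ∈ I) (h0 : volume A = 0) :
    volume ((fun (t : Fin k → ℝ) i => f (t i)) '' A) = 0 := by
  have key : ∀ t ∈ A, ∃ V ∈ 𝓝[A] t, ∃ K : NNReal,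
      LipschitzOnWith K (fun (t : Fin k → ℝ) i => f (t i)) (V ∩ A) := by
    intro t ht
    have h1 : ∀ i, ∃ K : NNReal, ∃ U ∈ 𝓝[I] (t i), LipschitzOnWith K f U :=
      fun i => hf (hA t ht i)
    choose K U hU hL using h1
    refine ⟨{s | ∀ i, s i ∈ U i}, ?_, ∑ i, K i, ?_⟩
    · have : ∀ i, ∀ᶠ s in 𝓝[A] t, s i ∈ U i := by
        intro i
        have hc : Tendsto (fun s : Fin k → ℝ => s i) (𝓝[A] t) (𝓝[I] (t i)) := by
          refine tendsto_nhdsWithin_iff.2 ⟨?_, ?_⟩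
          · exact ((continuous_apply i).tendsto t).mono_left nhdsWithin_le_nhds
          · filter_upwards [self_mem_nhdsWithin] with s hs using hA s hs i
        exact hc (hU i)
      exact eventually_all.2 this
    · intro s hs s' hs'
      rw [edist_pi_le_iff]
      intro i
      refine (hL i (hs.1 i) (hs'.1 i)).trans ?_
      gcongr
      · exact_mod_cast Finset.single_le_sum (f := K) (fun _ _ => zero_le) (Finset.mem_univ i)
      · exact edist_le_pi_edist s s' i
  choose! V hV hK using key
  obtain ⟨T, hTA, hTc, hcov⟩ := TopologicalSpace.countable_cover_nhdsWithin hV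
  have : (fun (t : Fin k → ℝ) i => f (t i)) '' A ⊆
      ⋃ x ∈ T, (fun (t : Fin k → ℝ) i => f (t i)) '' (V x ∩ A) := by
    rintro _ ⟨a, ha, rfl⟩
    obtain ⟨x, hx, hax⟩ := mem_iUnion₂.1 (hcov ha)
    exact mem_iUnion₂.2 ⟨x, hx, a, ⟨hax, ha⟩, rfl⟩
  refine measure_mono_null this ((measure_biUnion_null_iff hTc).2 fun x hx => ?_)
  obtain ⟨K, hKx⟩ := hK x (hTA hx)
  have h2 := hKx.hausdorffMeasure_image_le (d := (Fintype.card (Fin k) : ℝ)) (by positivity)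
  rw [hausdorffMeasure_pi_real,
    measure_mono_null (inter_subset_right) h0, mul_zero] at h2
  exact le_antisymm h2 zero_le

/-! ### Abstract generators -/

structure Gen (η : ℝ → ℝ) : Prop where
  cont : ContinuousOn η (Ici 0)
  zero : η 0 = 1
  anti : StrictAntiOn η (Ici 0)
  lim : Tendsto η atTop (𝓝 0)
  conv : ConvexOn ℝ (Ioi 0) η

namespace Gen
variable {η : ℝ → ℝ} (h : Gen η)

lemma pos (h : Gen η) {z : ℝ} (hz : 0 ≤ z) : 0 < η z := by
  have h1 : η (z+1) < η z := h.anti hz (by simp; linarith) (by linarith)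
  have h2 : 0 ≤ η (z+1) := by
    refine le_of_tendsto h.lim ?_
    filter_upwards [eventually_ge_atTop (z+1)] with w hw
    exact h.anti.antitoneOn (by simp; linarith) (by simp; linarith) hw
  linarith

lemma exists_inv (h : Gen η) {u : ℝ} (hu : u ∈ Ioc (0:ℝ) 1) : ∃ z, 0 ≤ z ∧ η z = u := by
  obtain ⟨b, hb, hb0⟩ := ((h.lim.eventually (gt_mem_nhds hu.1)).and (eventually_ge_atTop 0)).exists
  have := intermediate_value_Icc' hb0 (h.cont.mono Icc_subset_Ici_self)
  obtain ⟨z, hz, hzu⟩ := this ⟨hb.le, by rw [h.zero]; exact hu.2⟩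
  exact ⟨z, hz.1, hzu⟩

lemma inv_eta (h : Gen η) {z : ℝ} (hz : 0 ≤ z) : pseudoInv η (η z) = z := by
  unfold pseudoInv
  have : {w | 0 ≤ w ∧ η w ≤ η z} = Ici z := by
    ext w
    simp only [mem_ofPred_eq, mem_Ici]
    constructor
    · rintro ⟨h1, h2⟩
      exact (h.anti.le_iff_ge h1 hz).1 h2
    · intro h1
      exact ⟨hz.trans h1, (h.anti.le_iff_ge (hz.trans h1) hz).2 h1⟩
  rw [this, csInf_Ici]

lemma inv_nonneg (u : ℝ) : 0 ≤ pseudoInv η u := Real.sInf_nonneg fun _ hz => hz.1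

lemma eta_inv (h : Gen η) {u : ℝ} (hu : u ∈ Ioc (0:ℝ) 1) : η (pseudoInv η u) = u := by
  obtain ⟨z, hz, rfl⟩ := h.exists_inv hu
  rw [h.inv_eta hz]

lemma le_one (h : Gen η) {z : ℝ} (hz : 0 ≤ z) : η z ≤ 1 := by
  rw [← h.zero]; exact h.anti.antitoneOn (by simp) hz hz

lemma lt_one (h : Gen η) {z : ℝ} (hz : 0 < z) : η z < 1 := by
  rw [← h.zero]; exact h.anti (by simp) hz.le hz

lemma inv_pos (h : Gen η) {u : ℝ} (hu : u ∈ Ioo (0:ℝ) 1) : 0 < pseudoInv η u := by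
  obtain ⟨z, hz, rfl⟩ := h.exists_inv ⟨hu.1, hu.2.le⟩
  rw [h.inv_eta hz]
  rcases hz.eq_or_lt with rfl | h1
  · rw [h.zero] at hu; exact absurd hu.2 (lt_irrefl _)
  · exact h1

lemma le_inv_iff (h : Gen η) {u z : ℝ} (hu : u ∈ Ioc (0:ℝ) 1) (hz : 0 ≤ z) :
    z ≤ pseudoInv η u ↔ u ≤ η z := by
  obtain ⟨w, hw, rfl⟩ := h.exists_inv hu
  rw [h.inv_eta hw]
  exact (h.anti.le_iff_ge hw hz).symm

lemma measurable_inv (h : Gen η) : Measurable (pseudoInv η) := by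
  refine measurable_of_restrict_of_restrict_compl (s := Ioi (0:ℝ)) measurableSet_Ioi ?_ ?_
  · have : Antitone ((Ioi (0:ℝ)).domRestrict (pseudoInv η)) := by
      intro a b hab
      simp only [domRestrict_apply]
      refine csInf_le_csInf ⟨0, fun z hz => hz.1⟩ ?_ ?_
      · obtain ⟨z, hz, hz0⟩ := ((h.lim.eventually (gt_mem_nhds a.2)).and (eventually_ge_atTop 0)).exists
        exact ⟨z, hz0, hz.le⟩
      · exact fun z hz => ⟨hz.1, hz.2.trans hab⟩
    exact this.measurable
  · have : ((Ioi (0:ℝ))ᶜ).domRestrict (pseudoInv η) = fun _ => 0 := by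
      ext ⟨a, ha⟩
      simp only [domRestrict_apply]
      unfold pseudoInv
      have : {z | 0 ≤ z ∧ η z ≤ a} = ∅ := by
        ext z
        simp only [mem_ofPred_eq, mem_empty_iff_false, iff_false, not_and, not_le]
        intro hz
        have := h.pos hz
        simp at ha
        linarith
      rw [this, Real.sInf_empty]
    rw [this]
    exact measurable_const

lemma locLip_inv (h : Gen η) : LocallyLipschitzOn (Ioo (0:ℝ) 1) (pseudoInv η) := by
  intro u hu
  have hu2 : u / 2 ∈ Ioc (0:ℝ) 1 := ⟨by linarith [hu.1], by linarith [hu.1, hu.2]⟩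
  obtain ⟨c, hc, hcu⟩ := h.exists_inv hu2
  have hk : 0 < η c - η (c+1) := by
    have := h.anti (a := c) (b := c+1) hc (by simp; linarith) (by linarith)
    linarith
  have main : ∀ z1 z2 : ℝ, 0 < z2 → z2 < z1 → z1 < c →
      (η c - η (c+1)) * (z1 - z2) ≤ η z2 - η z1 := by
    intro z1 z2 h0 h1 h2
    have a1 := h.conv.slope_mono_adjacent (x := z2) (y := z1) (z := c) h0
      (by simp; linarith) h1 h2
    have a2 := h.conv.slope_mono_adjacent (x := z1) (y := c) (z := c+1) (by simp; linarith)
      (by simp; linarith) h2 (by linarith)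
    have a3 := a1.trans a2
    rw [div_le_div_iff₀ (by linarith) (by linarith)] at a3
    nlinarith
  refine ⟨⟨(η c - η (c+1))⁻¹, by positivity⟩, Ioo (u/2) 1, ?_, ?_⟩
  · exact mem_nhdsWithin_of_mem_nhds (Ioo_mem_nhds (by linarith [hu.1]) hu.2)
  · have hlt : ∀ v ∈ Ioo (u/2) 1, ∃ z, 0 < z ∧ z < c ∧ η z = v := by
      intro v hv
      have hv' : v ∈ Ioo (0:ℝ) 1 := ⟨hu2.1.trans hv.1, hv.2⟩
      refine ⟨pseudoInv η v, h.inv_pos hv', ?_, h.eta_inv ⟨hv'.1, hv'.2.le⟩⟩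
      rw [← h.anti.lt_iff_gt hc (inv_nonneg v), h.eta_inv ⟨hv'.1, hv'.2.le⟩, hcu]
      exact hv.1
    refine LipschitzOnWith.of_dist_le_mul ?_
    intro v1 hv1 v2 hv2
    obtain ⟨z1, p1, l1, rfl⟩ := hlt v1 hv1
    obtain ⟨z2, p2, l2, rfl⟩ := hlt v2 hv2
    rw [h.inv_eta p1.le, h.inv_eta p2.le, Real.dist_eq, Real.dist_eq]
    change _ ≤ (η c - η (c+1))⁻¹ * _
    rw [inv_mul_eq_div, le_div_iff₀ hk, mul_comm]
    rcases lt_trichotomy z1 z2 with hh | hh | hh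
    · have := main z2 z1 p1 hh l2
      rw [abs_sub_comm, abs_of_pos (sub_pos.2 hh)]
      exact this.trans (le_abs_self _)
    · subst hh; simp
    · have := main z1 z2 p2 hh l1
      rw [abs_of_pos (sub_pos.2 hh), abs_sub_comm (η z1)]
      exact this.trans (le_abs_self _)

/-- Preimage of a null set under `pseudoInv` is null. -/
lemma null_down (h : Gen η) {k : ℕ} {B : Set (Fin k → ℝ)} (hB : volume B = 0) :
    volume {u : Fin k → ℝ | (∀ i, u i ∈ Ioo (0:ℝ) 1) ∧ (fun i => pseudoInv η (u i)) ∈ B} = 0 := by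
  have := null_image_coord (h.conv.locallyLipschitzOn isOpen_Ioi)
    (A := B ∩ {t | ∀ i, 0 < t i}) (fun t ht i => ht.2 i) (measure_mono_null inter_subset_left hB)
  refine measure_mono_null ?_ this
  rintro u ⟨hu, huB⟩
  exact ⟨_, ⟨huB, fun i => h.inv_pos (hu i)⟩, funext fun i => h.eta_inv ⟨(hu i).1, (hu i).2.le⟩⟩

lemma null_up (h : Gen η) {k : ℕ} {B : Set (Fin k → ℝ)} (hB : volume B = 0) :
    volume {z : Fin k → ℝ | (∀ i, 0 < z i) ∧ (fun i => η (z i)) ∈ B} = 0 := by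
  have := null_image_coord h.locLip_inv
    (A := B ∩ {t | ∀ i, t i ∈ Ioo (0:ℝ) 1}) (fun t ht i => ht.2 i)
    (measure_mono_null inter_subset_left hB)
  refine measure_mono_null ?_ this
  rintro u ⟨hu, huB⟩
  exact ⟨_, ⟨huB, fun i => ⟨h.pos (hu i).le, h.lt_one (hu i)⟩⟩,
    funext fun i => h.inv_eta (hu i).le⟩

lemma conc (h : Gen η) {k : ℕ} (μ : Measure (Fin k → ℝ)) [IsProbabilityMeasure μ]
    (hc : μ (unitCube k) = 1)
    (hμ : ∀ u : Fin k → ℝ, (∀ i, u i ∈ Ioc (0:ℝ) 1) →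
      μ (lowerBox u) = ENNReal.ofReal (η (∑ i, pseudoInv η (u i)))) :
    ∀ᵐ u ∂μ, ∀ i, u i ∈ Ioo (0:ℝ) 1 := by
  have hcube : ∀ᵐ u ∂μ, u ∈ unitCube k := by
    have hm : MeasurableSet (unitCube k) := by
      unfold unitCube
      measurability
    exact (prob_compl_eq_zero_iff hm).2 hc
  have h1 : pseudoInv η 1 = 0 := by rw [← h.zero, h.inv_eta le_rfl]
  have marg : ∀ i, ∀ a ∈ Ioc (0:ℝ) 1, μ {u | u i ≤ a} = ENNReal.ofReal a := by
    intro i a ha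
    have h2 := hμ (fun j => if j = i then a else 1) (by
      intro j; split_ifs
      · exact ha
      · simp)
    have h3 : ∑ j, pseudoInv η (if j = i then a else 1) = pseudoInv η a := by
      rw [Finset.sum_eq_single i]
      · simp
      · intro j _ hj; simp [hj, h1]
      · simp
    rw [h3, h.eta_inv ha] at h2
    rw [← h2]
    refine measure_congr ?_
    filter_upwards [hcube] with u hu
    refine propext ⟨fun hh j => ?_, fun hh => ?_⟩
    · by_cases hj : j = i
      · subst hj; simp only [if_true]; exact hh
      · simpa [hj] using (hu j).2
    · have := hh i
      simp only [if_true] at this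
      exact this
  refine ae_all_iff.2 fun i => ?_
  have e0 : μ {u | u i ≤ 0} = 0 := by
    refine le_antisymm (ENNReal.le_of_forall_pos_le_add ?_) zero_le
    intro ε hε _
    have hm : min (ε:ℝ) 1 ∈ Ioc (0:ℝ) 1 := ⟨by positivity, min_le_right _ _⟩
    calc μ {u | u i ≤ 0} ≤ μ {u | u i ≤ min (ε:ℝ) 1} :=
          measure_mono fun u hu => le_trans hu hm.1.le
      _ = ENNReal.ofReal (min (ε:ℝ) 1) := marg i _ hm
      _ ≤ ENNReal.ofReal ε := ENNReal.ofReal_le_ofReal (min_le_left _ _)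
      _ = 0 + ε := by simp
  have e1 : μ {u | 1 ≤ u i} = 0 := by
    refine le_antisymm (ENNReal.le_of_forall_pos_le_add ?_) zero_le
    intro ε hε _
    have hm : 1 - min (ε:ℝ) (1/2) ∈ Ioc (0:ℝ) 1 := by
      constructor
      · linarith [min_le_right (ε:ℝ) (1/2)]
      · have : 0 < min (ε:ℝ) (1/2) := by positivity
        linarith
    have hpos : 0 < min (ε:ℝ) (1/2) := by positivity
    calc μ {u | 1 ≤ u i} ≤ μ ({u | u i ≤ 1 - min (ε:ℝ) (1/2)}ᶜ) :=
          measure_mono fun u hu => by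
            simp only [mem_compl_iff, mem_ofPred_eq, not_le] at hu ⊢
            linarith
      _ = 1 - ENNReal.ofReal (1 - min (ε:ℝ) (1/2)) := by
          rw [prob_compl_eq_one_sub (by measurability), marg i _ hm]
      _ = ENNReal.ofReal (min (ε:ℝ) (1/2)) := by
          rw [← ENNReal.ofReal_one, ← ENNReal.ofReal_sub _ hm.1.le]; congr 1; ring
      _ ≤ ENNReal.ofReal ε := ENNReal.ofReal_le_ofReal (min_le_left _ _)
      _ = 0 + ε := by simp
  have a0 : ∀ᵐ u ∂μ, ¬ (u i ≤ 0) := measure_eq_zero_iff_ae_notMem.1 e0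
  have a1 : ∀ᵐ u ∂μ, ¬ (1 ≤ u i) := measure_eq_zero_iff_ae_notMem.1 e1
  filter_upwards [a0, a1] with u hu0 hu1
  exact ⟨not_le.1 hu0, not_le.1 hu1⟩

lemma measurable_invc (h : Gen η) (k : ℕ) :
    Measurable (fun (u : Fin k → ℝ) i => pseudoInv η (u i)) :=
  measurable_pi_lambda _ fun i => h.measurable_inv.comp (measurable_pi_apply i)

lemma map_Ici (h : Gen η) {k : ℕ} (μ : Measure (Fin k → ℝ)) [IsProbabilityMeasure μ]
    (hc : μ (unitCube k) = 1)
    (hμ : ∀ u : Fin k → ℝ, (∀ i, u i ∈ Ioc (0:ℝ) 1) →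
      μ (lowerBox u) = ENNReal.ofReal (η (∑ i, pseudoInv η (u i)))) (z : Fin k → ℝ)
    (hz : ∀ i, 0 ≤ z i) :
    μ.map (fun u i => pseudoInv η (u i)) (Ici z) = ENNReal.ofReal (η (∑ i, z i)) := by
  rw [Measure.map_apply (h.measurable_invc k) measurableSet_Ici]
  have h2 := hμ (fun i => η (z i)) (fun i => ⟨h.pos (hz i), h.le_one (hz i)⟩)
  simp only [h.inv_eta (hz _)] at h2
  rw [← h2]
  refine measure_congr ?_
  filter_upwards [h.conc μ hc hμ] with u hu
  refine propext (forall_congr' fun i => ?_)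
  exact h.le_inv_iff ⟨(hu i).1, (hu i).2.le⟩ (hz i)

lemma map_pos (h : Gen η) {k : ℕ} (μ : Measure (Fin k → ℝ)) [IsProbabilityMeasure μ]
    (hc : μ (unitCube k) = 1)
    (hμ : ∀ u : Fin k → ℝ, (∀ i, u i ∈ Ioc (0:ℝ) 1) →
      μ (lowerBox u) = ENNReal.ofReal (η (∑ i, pseudoInv η (u i)))) :
    ∀ᵐ z ∂(μ.map (fun u i => pseudoInv η (u i))), ∀ i, 0 < z i := by
  rw [ae_map_iff (h.measurable_invc k).aemeasurable (by measurability)]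
  filter_upwards [h.conc μ hc hμ] with u hu i
  exact h.inv_pos (hu i)

end Gen

lemma ext_Ici {k : ℕ} (μ ν : Measure (Fin k → ℝ)) [IsFiniteMeasure μ]
    (hμ : ∀ᵐ z ∂μ, ∀ i, 0 < z i) (hν : ∀ᵐ z ∂ν, ∀ i, 0 < z i)
    (hh : ∀ q : Fin k → ℚ, (∀ i, 0 ≤ q i) →
      μ (Ici (fun i => (q i : ℝ))) = ν (Ici (fun i => (q i : ℝ)))) : μ = ν := by
  have red : ∀ (τ : Measure (Fin k → ℝ)), (∀ᵐ z ∂τ, ∀ i, 0 < z i) → ∀ q : Fin k → ℚ,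
      τ (Ici (fun i => (q i : ℝ))) = τ (Ici (fun i => ((max (q i) 0 : ℚ) : ℝ))) := by
    intro τ hτ q
    refine measure_congr ?_
    filter_upwards [hτ] with z hz
    refine propext (forall_congr' fun i => ?_)
    push_cast
    exact ⟨fun h1 => max_le h1 (hz i).le, fun h1 => (le_max_left _ _).trans h1⟩
  have red' : ∀ (τ : Measure (Fin k → ℝ)), (∀ᵐ z ∂τ, ∀ i, 0 < z i) →
      τ univ = τ (Ici (fun i => (((0 : Fin k → ℚ) i : ℚ) : ℝ))) := by
    intro τ hτ
    refine measure_congr ?_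
    filter_upwards [hτ] with z hz
    refine propext ⟨fun _ i => ?_, fun _ => trivial⟩
    simpa using (hz i).le
  refine ext_of_generate_finite
    (Set.univ.pi '' Set.univ.pi (fun _ : Fin k => ⋃ a : ℚ, {Set.Ici (a:ℝ)})) ?_ ?_ ?_ ?_
  · rw [← generateFrom_pi_eq]
    · congr 1
      funext i
      rw [← Real.borel_eq_generateFrom_Ici_rat]
      exact BorelSpace.measurable_eq
    · intro i
      refine ⟨fun n : ℕ => Ici ((-(n:ℚ) : ℚ) : ℝ), fun n => mem_iUnion.2 ⟨_, rfl⟩, ?_⟩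
      refine eq_univ_of_forall fun x => ?_
      obtain ⟨n, hn⟩ := exists_nat_ge (-x)
      refine mem_iUnion.2 ⟨n, ?_⟩
      simp only [mem_Ici]; push_cast; linarith
  · exact IsPiSystem.pi fun _ => Real.isPiSystem_Ici_rat
  · rintro _ ⟨S, hS, rfl⟩
    have : ∀ i, ∃ q : ℚ, S i = Ici (q:ℝ) := by
      intro i
      obtain ⟨q, hq⟩ := mem_iUnion.1 (hS i trivial)
      exact ⟨q, hq⟩
    choose q hq using this
    have e : Set.univ.pi S = Ici (fun i => (q i : ℝ)) := by
      rw [← pi_univ_Ici]; congr 1; funext i; exact hq i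
    rw [e, red μ hμ, red ν hν, hh _ (fun i => le_max_right _ _)]
  · rw [red' μ hμ, red' ν hν]
    exact hh 0 (fun i => le_rfl)

/-! ### The signed derivatives of the generator -/

def sgnD (ψ : ℝ → ℝ) (j : ℕ) (z : ℝ) : ℝ := (-1 : ℝ) ^ j * iteratedDeriv j ψ z

section
variable {d : ℕ} {ψ φ : ℝ → ℝ}

lemma sgnD_zero (z : ℝ) : sgnD ψ 0 z = ψ z := by simp [sgnD]

lemma sgnD_deriv (hg : IsStrictGenerator d ψ φ) {j : ℕ} (hj : j + 1 ≤ d - 2) {z : ℝ} (hz : 0 < z) :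
    HasDerivAt (sgnD ψ j) (-(sgnD ψ (j+1) z)) z := by
  have h1 := hg.1.smooth z hz
  have h2 : DifferentiableAt ℝ (iteratedDeriv j ψ) z := by
    rw [iteratedDeriv_eq_equiv_comp]
    refine (LinearIsometryEquiv.differentiableAt _).comp z ?_
    refine h1.differentiableAt_iteratedFDeriv ?_
    exact_mod_cast hj
  have h3 := h2.hasDerivAt.const_mul ((-1:ℝ)^j)
  convert! h3 using 1
  simp only [sgnD, iteratedDeriv_succ, pow_succ]
  ring

lemma sgnD_nonneg (hg : IsStrictGenerator d ψ φ) {j : ℕ} (hj : j ≤ d - 2) {z : ℝ} (hz : 0 < z) :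
    0 ≤ sgnD ψ j z := hg.1.alt_sign j hj z hz

lemma sgnD_anti (hg : IsStrictGenerator d ψ φ) {j : ℕ} (hj : j ≤ d - 2) :
    AntitoneOn (sgnD ψ j) (Ioi 0) := by
  rcases hj.eq_or_lt with rfl | hj
  · exact hg.1.top_antitone
  · refine antitoneOn_of_deriv_nonpos (convex_Ioi 0) ?_ ?_ ?_
    · exact fun z hz => (sgnD_deriv hg hj hz).continuousAt.continuousWithinAt
    · rw [interior_Ioi]
      exact fun z hz => (sgnD_deriv hg hj hz).differentiableAt.differentiableWithinAt
    · rw [interior_Ioi]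
      intro z hz
      rw [(sgnD_deriv hg hj hz).deriv]
      linarith [sgnD_nonneg hg (Nat.succ_le_of_lt hj) hz]

lemma sgnD_conv (hg : IsStrictGenerator d ψ φ) {j : ℕ} (hj : j ≤ d - 2) :
    ConvexOn ℝ (Ioi 0) (sgnD ψ j) := by
  rcases hj.eq_or_lt with rfl | hj
  · exact hg.1.top_convex
  · refine MonotoneOn.convexOn_of_deriv (convex_Ioi 0) ?_ ?_ ?_
    · exact fun z hz => (sgnD_deriv hg hj hz).continuousAt.continuousWithinAt
    · rw [interior_Ioi]
      exact fun z hz => (sgnD_deriv hg hj hz).differentiableAt.differentiableWithinAt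
    · rw [interior_Ioi]
      intro z hz w hw hzw
      rw [(sgnD_deriv hg hj hz).deriv, (sgnD_deriv hg hj hw).deriv]
      exact neg_le_neg (sgnD_anti hg (Nat.succ_le_of_lt hj) hz hw hzw)

lemma sgnD_lim (hg : IsStrictGenerator d ψ φ) : ∀ {j : ℕ}, j ≤ d - 2 →
    Tendsto (sgnD ψ j) atTop (𝓝 0) := by
  intro j
  induction j with
  | zero =>
    intro _
    have : sgnD ψ 0 = ψ := funext sgnD_zero
    rw [this]; exact hg.1.tendsto_zero
  | succ j ih =>
    intro hj
    have h1 := ih (by omega)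
    have h2 : Tendsto (fun z => sgnD ψ j (z + -1)) atTop (𝓝 0) :=
      h1.comp (tendsto_atTop_add_const_right _ _ tendsto_id)
    refine squeeze_zero' ?_ ?_ h2
    · filter_upwards [eventually_gt_atTop 0] with z hz using sgnD_nonneg hg hj hz
    · filter_upwards [eventually_gt_atTop 1] with z hz
      obtain ⟨c, hc, hc'⟩ := exists_hasDerivAt_eq_slope (sgnD ψ j) (fun z => -(sgnD ψ (j+1) z))
        (a := z + -1) (b := z) (by linarith)
        (fun w hw => (sgnD_deriv hg hj (by linarith [hw.1])).continuousAt.continuousWithinAt)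
        (fun w hw => sgnD_deriv hg hj (by linarith [hw.1]))
      have e : z - (z + -1) = 1 := by ring
      rw [e, div_one] at hc'
      have h3 := sgnD_anti hg hj (a := c) (b := z) (by simp; linarith [hc.1])
        (by simp; linarith) hc.2.le
      have h4 := sgnD_nonneg hg (j := j) (by omega) (z := z) (by linarith)
      linarith

lemma sgnD_pos (hg : IsStrictGenerator d ψ φ) : ∀ {j : ℕ}, j ≤ d - 2 → ∀ {z : ℝ}, 0 < z →
    0 < sgnD ψ j z := by
  intro j
  induction j with
  | zero =>
    intro _ z hz
    rw [sgnD_zero]; exact hg.2.1 z hz.le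
  | succ j ih =>
    intro hj z hz
    refine lt_of_le_of_ne (sgnD_nonneg hg hj hz) fun h0 => ?_
    have hzero : ∀ w, z ≤ w → sgnD ψ (j+1) w = 0 := by
      intro w hw
      refine le_antisymm ?_ (sgnD_nonneg hg hj (by linarith))
      rw [h0]
      exact sgnD_anti hg hj hz (by simp; linarith) hw
    have hz0 : sgnD ψ j z ≤ 0 := by
      refine ge_of_tendsto (sgnD_lim hg (j := j) (by omega)) ?_
      filter_upwards [eventually_gt_atTop z] with w hw
      obtain ⟨c, hc, hc'⟩ := exists_hasDerivAt_eq_slope (sgnD ψ j) (fun z => -(sgnD ψ (j+1) z))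
        (a := z) (b := w) hw
        (fun w hw => (sgnD_deriv hg hj (by linarith [hw.1])).continuousAt.continuousWithinAt)
        (fun w hw => sgnD_deriv hg hj (by linarith [hw.1]))
      rw [hzero c hc.1.le, neg_zero, eq_comm, div_eq_zero_iff] at hc'
      rcases hc' with h | h <;> linarith
    linarith [ih (by omega) hz]

lemma sgnD_strictAnti (hg : IsStrictGenerator d ψ φ) {j : ℕ} (hj : j ≤ d - 2) :
    StrictAntiOn (sgnD ψ j) (Ioi 0) := by
  intro a ha b hb hab
  refine lt_of_le_of_ne (sgnD_anti hg hj ha hb hab.le) fun h0 => ?_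
  have : sgnD ψ j b ≤ 0 := by
    refine ge_of_tendsto (sgnD_lim hg hj) ?_
    filter_upwards [eventually_gt_atTop b] with c hc
    have := (sgnD_conv hg hj).slope_mono_adjacent (x := a) (y := b) (z := c) ha
      (lt_trans hb hc) hab hc
    rw [h0, sub_self, zero_div] at this
    have h2 := (div_nonneg_iff.1 this)
    rcases h2 with h2 | h2 <;> linarith [h2.1, h2.2]
  linarith [sgnD_pos hg hj hb]

lemma gen_psi (hg : IsStrictGenerator d ψ φ) : Gen ψ where
  cont := hg.1.continuousOn
  zero := hg.1.at_zero
  anti := fun a ha b _ hab => hg.1.strict_anti a b ha hab (hg.2.1 b (le_trans ha hab.le))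
  lim := hg.1.tendsto_zero
  conv := by
    have := sgnD_conv hg (j := 0) (by omega)
    rwa [show sgnD ψ 0 = ψ from funext sgnD_zero] at this

lemma psiX_eq {l : ℕ} (x : Fin l → ℝ) (z : ℝ) :
    psiX ψ φ x z = sgnD ψ l ((∑ i, φ (x i)) + z) / sgnD ψ l (∑ i, φ (x i)) := by
  unfold psiX sgnD
  rw [mul_div_mul_left]
  positivity

lemma gen_psiX (hg : IsStrictGenerator d ψ φ) {l : ℕ} (hl : l ≤ d - 2) (x : Fin l → ℝ)
    (hs : 0 < ∑ i, φ (x i)) : Gen (psiX ψ φ x) := by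
  have e : psiX ψ φ x = fun z => sgnD ψ l ((∑ i, φ (x i)) + z) / sgnD ψ l (∑ i, φ (x i)) :=
    funext (psiX_eq x)
  rw [e]
  set s := ∑ i, φ (x i)
  have hp := sgnD_pos hg hl hs
  constructor
  · refine ContinuousOn.div_const ?_ _
    refine ((sgnD_conv hg hl).continuousOn isOpen_Ioi).comp (by fun_prop) ?_
    intro z hz
    exact add_pos_of_pos_of_nonneg hs hz
  · rw [add_zero, div_self hp.ne']
  · intro a ha b hb hab
    refine div_lt_div_of_pos_right ?_ hp
    exact sgnD_strictAnti hg hl (add_pos_of_pos_of_nonneg hs ha) (add_pos_of_pos_of_nonneg hs hb)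
      (by linarith)
  · have := ((sgnD_lim hg hl).comp (tendsto_atTop_add_const_left _ s tendsto_id)).div_const
      (sgnD ψ l s)
    simpa using this
  · refine ⟨convex_Ioi 0, ?_⟩
    intro a ha b hb p q hp0 hq0 hpq
    have := (sgnD_conv hg hl).2 (x := s + a) (y := s + b) (add_pos hs ha) (add_pos hs hb)
      hp0 hq0 hpq
    simp only [smul_eq_mul] at this ⊢
    have e1 : p * (s + a) + q * (s + b) = s + (p * a + q * b) := by
      linear_combination s * hpq
    rw [e1] at this
    rw [← mul_div_assoc, ← mul_div_assoc, ← add_div]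
    exact div_le_div_of_nonneg_right this hp.le

lemma lint_one (hg : IsStrictGenerator d ψ φ) {j : ℕ} (hj : j + 1 ≤ d - 2) {s : ℝ}
    (hs : 0 < s ∨ (s = 0 ∧ j = 0)) :
    ∫⁻ t in Ioi (0:ℝ), ENNReal.ofReal (sgnD ψ (j+1) (s + t)) = ENNReal.ofReal (sgnD ψ j s) := by
  have hs0 : 0 ≤ s := by rcases hs with h | h <;> [exact h.le; exact h.1.ge]
  have c : ContinuousWithinAt (fun t => sgnD ψ j (s + t)) (Ici 0) 0 := by
    rcases hs with h | ⟨rfl, rfl⟩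
    · have h1 : ContinuousAt (sgnD ψ j) (s + 0) := by
        rw [add_zero]; exact (sgnD_deriv hg hj h).continuousAt
      exact (ContinuousAt.comp (g := sgnD ψ j) (f := fun t => s + t) h1 (by fun_prop)).continuousWithinAt
    · simp only [sgnD_zero, zero_add]
      exact hg.1.continuousOn 0 (by simp)
  have dd : ∀ t ∈ Ioi (0:ℝ), HasDerivAt (fun t => sgnD ψ j (s + t)) (-(sgnD ψ (j+1) (s+t))) t := by
    intro t ht
    exact (sgnD_deriv hg hj (add_pos_of_nonneg_of_pos hs0 ht)).comp_const_add s t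
  have np : ∀ t ∈ Ioi (0:ℝ), -(sgnD ψ (j+1) (s+t)) ≤ 0 := fun t ht =>
    neg_nonpos.2 (sgnD_nonneg hg hj (add_pos_of_nonneg_of_pos hs0 ht))
  have lm : Tendsto (fun t => sgnD ψ j (s + t)) atTop (𝓝 0) :=
    (sgnD_lim hg (j := j) (by omega)).comp (tendsto_atTop_add_const_left _ s tendsto_id)
  have i1 := integral_Ioi_of_hasDerivAt_of_nonpos c dd np lm
  have i2 := integrableOn_Ioi_deriv_of_nonpos c dd np lm
  rw [integral_neg, add_zero, zero_sub, neg_inj] at i1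
  rw [← i1, ofReal_integral_eq_lintegral_ofReal]
  · have i3 : IntegrableOn (fun x => sgnD ψ (j+1) (s+x)) (Ioi 0) := by simpa using i2.neg
    exact i3
  · filter_upwards [ae_restrict_mem measurableSet_Ioi] with t ht
    simpa using np t ht

end

def posCone (k : ℕ) : Set (Fin k → ℝ) := {t | ∀ i, 0 < t i}

lemma measurableSet_posCone (k : ℕ) : MeasurableSet (posCone k) := by
  unfold posCone; measurability

lemma measurable_sgnD (ψ : ℝ → ℝ) (j : ℕ) : Measurable (sgnD ψ (j+1)) := by
  unfold sgnD
  simp only [iteratedDeriv_succ]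
  exact (measurable_deriv _).const_mul _

/-- Density of the conditional structure on the positive cone. -/
def dens (ψ : ℝ → ℝ) (j : ℕ) (s : ℝ) (t : Fin j → ℝ) : ℝ≥0∞ :=
  (posCone j).indicator (fun t => ENNReal.ofReal (sgnD ψ j (s + ∑ i, t i))) t

lemma measurable_dens (ψ : ℝ → ℝ) (j : ℕ) (s : ℝ) : Measurable (dens ψ (j+1) s) := by
  refine Measurable.indicator ?_ (measurableSet_posCone _)
  refine ENNReal.measurable_ofReal.comp ((measurable_sgnD ψ j).comp ?_)
  fun_prop

lemma dens_cons (ψ : ℝ → ℝ) (j : ℕ) (s x : ℝ) (y : Fin j → ℝ) :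
    dens ψ (j+1) s (Fin.cons x y) = (posCone j).indicator (fun y =>
      (Ioi (0:ℝ)).indicator (fun x => ENNReal.ofReal (sgnD ψ (j+1) ((s + ∑ i, y i) + x))) x) y := by
  unfold dens
  by_cases hy : y ∈ posCone j
  · rw [indicator_of_mem hy]
    by_cases hx : x ∈ Ioi (0:ℝ)
    · rw [indicator_of_mem hx, indicator_of_mem]
      · rw [Fin.sum_cons]; congr 2; ring
      · intro i
        refine Fin.cases ?_ (fun i => ?_) i
        · simpa using hx
        · simpa using hy i
    · rw [indicator_of_notMem hx, indicator_of_notMem]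
      intro h
      exact hx (by simpa using h 0)
  · rw [indicator_of_notMem hy, indicator_of_notMem]
    intro h
    exact hy fun i => by simpa using h i.succ

lemma lint_dens {d : ℕ} {ψ φ : ℝ → ℝ} (hg : IsStrictGenerator d ψ φ) :
    ∀ {j : ℕ}, j ≤ d - 2 → ∀ {s : ℝ}, 0 ≤ s → ∫⁻ t, dens ψ j s t = ENNReal.ofReal (ψ s) := by
  intro j
  induction j with
  | zero =>
    intro _ s hs
    have : ∀ t : Fin 0 → ℝ, dens ψ 0 s t = ENNReal.ofReal (ψ s) := by
      intro t
      unfold dens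
      rw [indicator_of_mem]
      · simp [sgnD_zero]
      · exact fun i => i.elim0
    simp only [this, lintegral_const]
    have h1 : (volume : Measure (Fin 0 → ℝ)) univ = 1 := by
      rw [volume_pi, Measure.pi_univ]; simp
    rw [h1, mul_one]
  | succ j ih =>
    intro hj s hs
    have mp := (volume_preserving_piFinSuccAbove (fun _ : Fin (j+1) => ℝ) 0).symm
    rw [← mp.lintegral_comp (measurable_dens ψ j s), Measure.volume_eq_prod, lintegral_prod_symm]
    · have hin : ∀ y : Fin j → ℝ, ∫⁻ x : ℝ, dens ψ (j+1) s
          ((MeasurableEquiv.piFinSuccAbove (fun _ : Fin (j+1) => ℝ) 0).symm (x, y)) =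
          dens ψ j s y := by
        intro y
        have e : ∀ x : ℝ, (MeasurableEquiv.piFinSuccAbove (fun _ : Fin (j+1) => ℝ) 0).symm (x, y)
            = Fin.cons x y := by
          intro x
          simp [MeasurableEquiv.piFinSuccAbove, Fin.insertNthEquiv]
        simp only [e, dens_cons]
        by_cases hy : y ∈ posCone j
        · simp only [indicator_of_mem hy, dens]
          rw [lintegral_indicator measurableSet_Ioi, lint_one hg hj]
          rcases Nat.eq_zero_or_pos j with rfl | hj0
          · rcases hs.eq_or_lt with rfl | hs
            · right; simp
            · left; simpa using hs
          · left
            have : Nonempty (Fin j) := ⟨⟨0, hj0⟩⟩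
            have := Finset.sum_pos (s := Finset.univ) (f := y) (fun i _ => hy i)
              Finset.univ_nonempty
            linarith
        · simp [indicator_of_notMem hy, dens]
      simp only [hin]
      exact ih (by omega) hs
    · exact ((measurable_dens ψ j s).comp (MeasurableEquiv.measurable _)).aemeasurable

lemma lint_dens_Ici {d : ℕ} {ψ φ : ℝ → ℝ} (hg : IsStrictGenerator d ψ φ)
    {j : ℕ} (hj : j ≤ d - 2) {s : ℝ} (hs : 0 ≤ s) (w : Fin j → ℝ) (hw : ∀ i, 0 ≤ w i) :
    ∫⁻ t in Ici w, dens ψ j s t = ENNReal.ofReal (ψ (s + ∑ i, w i)) := by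
  rw [← lint_dens hg hj (add_nonneg hs (Finset.sum_nonneg fun i _ => hw i))]
  have e : (Set.univ.pi fun i => Ioi (w i)) =ᵐ[(volume : Measure (Fin j → ℝ))] Ici w :=
    Measure.univ_pi_Ioi_ae_eq_Ici
  rw [← setLIntegral_congr e, ← lintegral_indicator (MeasurableSet.univ_pi fun i => measurableSet_Ioi),
    ← lintegral_add_right_eq_self _ w]
  refine lintegral_congr fun t => ?_
  have e1 : s + ∑ i, (t + w) i = s + ∑ i, w i + ∑ i, t i := by
    simp only [Pi.add_apply, Finset.sum_add_distrib]; ring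
  unfold dens
  by_cases ht : t ∈ posCone j
  · rw [indicator_of_mem ht, indicator_of_mem, indicator_of_mem, e1]
    · exact fun i => add_pos_of_pos_of_nonneg (ht i) (hw i)
    · intro i _
      simpa using ht i
  · rw [indicator_of_notMem ht, indicator_of_notMem]
    intro h
    exact ht fun i => by simpa using h i trivial

def splitE (l m : ℕ) : (Fin (l+m) → ℝ) ≃ᵐ (Fin l → ℝ) × (Fin m → ℝ) :=
  (MeasurableEquiv.piCongrLeft (fun _ => ℝ) finSumFinEquiv).symm.trans
    (MeasurableEquiv.sumPiEquivProdPi (fun _ : Fin l ⊕ Fin m => ℝ))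

lemma splitE_apply (l m : ℕ) (z : Fin (l+m) → ℝ) :
    splitE l m z = (fun i => z (Fin.castAdd m i), fun j => z (Fin.natAdd l j)) := rfl

lemma splitE_mp (l m : ℕ) : MeasurePreserving (splitE l m) volume volume :=
  (volume_measurePreserving_piCongrLeft (fun _ : Fin (l+m) => ℝ) finSumFinEquiv).symm.trans
    (volume_measurePreserving_sumPiEquivProdPi (fun _ : Fin l ⊕ Fin m => ℝ))

lemma core {j m : ℕ} {ψ φ : ℝ → ℝ} (hl : j + 1 ≤ j + 1 + m - 2)
    (hg : IsStrictGenerator (j + 1 + m) ψ φ)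
    (ρ : Measure (Fin (j + 1 + m) → ℝ)) [IsProbabilityMeasure ρ]
    (hsing : ρ ⟂ₘ volume) (hpos : ∀ᵐ z ∂ρ, ∀ i, 0 < z i)
    (hI : ∀ z : Fin (j+1+m) → ℝ, (∀ i, 0 ≤ z i) → ρ (Ici z) = ENNReal.ofReal (ψ (∑ i, z i))) :
    ∀ᵐ w : Fin (j+1) → ℝ, w ∈ posCone (j+1) → ∃ κ : Measure (Fin m → ℝ),
      IsProbabilityMeasure κ ∧ κ ⟂ₘ volume ∧ (∀ᵐ z ∂κ, ∀ i, 0 < z i) ∧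
      ∀ q : Fin m → ℚ, (∀ i, 0 ≤ q i) → κ (Ici (fun i => (q i : ℝ))) =
        ENNReal.ofReal (sgnD ψ (j+1) ((∑ i, w i) + ∑ i, (q i : ℝ)) / sgnD ψ (j+1) (∑ i, w i)) := by
  obtain ⟨N, hNm, hN1, hN2⟩ := hsing
  set E := splitE (j+1) m with hE
  set r : Measure ((Fin (j+1) → ℝ) × (Fin m → ℝ)) := ρ.map E with hr
  have : IsProbabilityMeasure r := Measure.isProbabilityMeasure_map E.measurable.aemeasurable
  -- `Nᶜ` is the Lebesgue null carrier
  set S : Set ((Fin (j+1) → ℝ) × (Fin m → ℝ)) := E.symm ⁻¹' Nᶜ with hS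
  have hSm : MeasurableSet S := E.symm.measurable hNm.compl
  have hS0 : (volume : Measure ((Fin (j+1) → ℝ) × (Fin m → ℝ))) S = 0 := by
    rw [hS, (splitE_mp (j+1) m).symm.measure_preimage hNm.compl.nullMeasurableSet, hN2]
  have hrS : ∀ᵐ p ∂r, p ∈ S := by
    rw [hr, ae_map_iff (p := fun p => p ∈ S) E.measurable.aemeasurable hSm]
    have : ∀ᵐ z ∂ρ, z ∉ N := measure_eq_zero_iff_ae_notMem.1 hN1
    filter_upwards [this] with z hz
    simpa [hS] using hz
  have hrpos : ∀ᵐ p ∂r, p.1 ∈ posCone (j+1) ∧ p.2 ∈ posCone m := by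
    rw [hr, ae_map_iff E.measurable.aemeasurable]
    · filter_upwards [hpos] with z hz
      exact ⟨fun i => hz _, fun i => hz _⟩
    · exact (measurable_fst (measurableSet_posCone _)).inter
        (measurable_snd (measurableSet_posCone _))
  have hrI : ∀ (w : Fin (j+1) → ℝ) (y : Fin m → ℝ), (∀ i, 0 ≤ w i) → (∀ i, 0 ≤ y i) →
      r (Ici w ×ˢ Ici y) = ENNReal.ofReal (ψ ((∑ i, y i) + ∑ i, w i)) := by
    intro w y hw hy
    rw [hr, Measure.map_apply E.measurable (measurableSet_Ici.prod measurableSet_Ici)]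
    have e : E ⁻¹' (Ici w ×ˢ Ici y) = Ici (Fin.append w y) := by
      ext z
      simp only [mem_preimage, mem_prod, mem_Ici, hE, splitE_apply, Pi.le_def]
      constructor
      · rintro ⟨h1, h2⟩ i
        refine Fin.addCases (fun i => ?_) (fun i => ?_) i
        · simpa using h1 i
        · simpa using h2 i
      · intro h
        exact ⟨fun i => by simpa using h (Fin.castAdd m i),
          fun i => by simpa using h (Fin.natAdd (j+1) i)⟩
    rw [e, hI, Fin.sum_univ_add]
    · simp [add_comm]
    · intro i
      refine Fin.addCases (fun i => ?_) (fun i => ?_) i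
      · simpa using hw i
      · simpa using hy i
  -- fibre measures
  have hfib : ∀ y : Fin m → ℝ, (∀ i, 0 ≤ y i) →
      (r.restrict (univ ×ˢ Ici y)).fst = volume.withDensity (dens ψ (j+1) (∑ i, y i)) := by
    intro y hy
    refine ext_Ici _ _ ?_ ?_ ?_
    · have : ∀ᵐ p ∂(r.restrict (univ ×ˢ Ici y)), p.1 ∈ posCone (j+1) :=
        ae_restrict_of_ae (hrpos.mono fun p hp => hp.1)
      rw [Measure.fst, ae_map_iff measurable_fst.aemeasurable (measurableSet_posCone _)]
      exact this
    · have hh : volume.withDensity (dens ψ (j+1) (∑ i, y i)) (posCone (j+1))ᶜ = 0 := by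
        rw [withDensity_apply _ (measurableSet_posCone _).compl]
        rw [setLIntegral_eq_zero_iff (measurableSet_posCone _).compl (measurable_dens _ _ _)]
        refine Eventually.of_forall fun t ht => ?_
        exact indicator_of_notMem ht _
      exact (measure_eq_zero_iff_ae_notMem.1 hh).mono fun t ht => not_not.1 ht
    · intro q hq
      have hq' : ∀ i, (0:ℝ) ≤ q i := fun i => by exact_mod_cast hq i
      rw [Measure.fst_apply measurableSet_Ici, Measure.restrict_apply (measurable_fst measurableSet_Ici),
        withDensity_apply _ measurableSet_Ici,
        lint_dens_Ici hg hl (Finset.sum_nonneg fun i _ => hy i) _ hq', ← hrI _ _ hq' hy]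
      congr 1
      ext p
      simp only [mem_inter_iff, mem_preimage, mem_prod, mem_univ, true_and]
  have hfst : r.fst = volume.withDensity (dens ψ (j+1) 0) := by
    have h0 := hfib 0 (fun i => le_rfl)
    have e : r.restrict (univ ×ˢ Ici (0 : Fin m → ℝ)) = r := by
      refine Measure.restrict_eq_self_of_ae_mem ?_
      filter_upwards [hrpos] with p hp
      exact ⟨trivial, fun i => (hp.2 i).le⟩
    rw [e] at h0
    simpa using h0
  set κ := r.condKernel with hκ
  have hdis : r.fst ⊗ₘ κ = r := r.disintegrate κ
  have hae : ∀ y : Fin m → ℝ, (∀ i, 0 ≤ y i) → ∀ᵐ w : Fin (j+1) → ℝ,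
      dens ψ (j+1) 0 w * κ w (Ici y) = dens ψ (j+1) (∑ i, y i) w := by
    intro y hy
    have hm1 : Measurable fun w => κ w (Ici y) := κ.measurable_coe measurableSet_Ici
    refine (withDensity_eq_iff_of_sigmaFinite (f := dens ψ (j+1) 0 * fun w => κ w (Ici y)) (g := dens ψ (j+1) (∑ i, y i)) ?_ ?_).1 ?_
    · exact ((measurable_dens ψ j 0).mul hm1).aemeasurable
    · exact (measurable_dens ψ j _).aemeasurable
    rw [← hfib y hy]
    ext A hA
    rw [Measure.fst_apply hA, Measure.restrict_apply (measurable_fst hA)]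
    have e : Prod.fst ⁻¹' A ∩ univ ×ˢ Ici y = A ×ˢ Ici y := by ext p; simp
    rw [e, ← hdis, Measure.compProd_apply_prod hA measurableSet_Ici, hfst,
      restrict_withDensity hA, lintegral_withDensity_eq_lintegral_mul _ (measurable_dens ψ j 0) hm1,
      withDensity_apply _ hA]
  have hall : ∀ᵐ w : Fin (j+1) → ℝ, ∀ q : Fin m → ℚ, (∀ i, 0 ≤ q i) →
      dens ψ (j+1) 0 w * κ w (Ici (fun i => (q i:ℝ))) = dens ψ (j+1) (∑ i, (q i:ℝ)) w := by
    refine ae_all_iff.2 fun q => ?_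
    by_cases hq : ∀ i, 0 ≤ q i
    · filter_upwards [hae (fun i => (q i:ℝ)) (fun i => by exact_mod_cast hq i)] with w hw _
      exact hw
    · exact Eventually.of_forall fun w h => absurd h hq
  have hk : ∀ᵐ w ∂r.fst, ∀ᵐ y ∂(κ w), (w, y) ∈ S ∧ y ∈ posCone m := by
    refine Measure.ae_ae_of_ae_compProd (p := fun p => p ∈ S ∧ p.2 ∈ posCone m) ?_
    rw [hdis]
    filter_upwards [hrS, hrpos] with p h1 h2 using ⟨h1, h2.2⟩
  rw [hfst, ae_withDensity_iff (measurable_dens ψ j 0)] at hk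
  have hS' : ∀ᵐ w : Fin (j+1) → ℝ, volume (Prod.mk w ⁻¹' S) = 0 := by
    rw [Measure.volume_eq_prod] at hS0
    exact Measure.measure_ae_null_of_prod_null hS0
  filter_upwards [hall, hk, hS'] with w h1 h2 h3 hw
  have hwpos : 0 < ∑ i, w i :=
    Finset.sum_pos (fun i _ => hw i) Finset.univ_nonempty
  have hF : 0 < sgnD ψ (j+1) (∑ i, w i) := sgnD_pos hg hl hwpos
  have hd : ∀ s, dens ψ (j+1) s w = ENNReal.ofReal (sgnD ψ (j+1) (s + ∑ i, w i)) := fun s =>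
    indicator_of_mem hw _
  have hd0 : dens ψ (j+1) 0 w ≠ 0 := by
    rw [hd, zero_add]; simpa using hF
  have h2' := h2 hd0
  refine ⟨κ w, inferInstance, ?_, ?_, ?_⟩
  · refine ⟨(Prod.mk w ⁻¹' S)ᶜ, (measurable_prodMk_left hSm).compl, ?_, ?_⟩
    · exact h2'.mono fun y hy => hy.1
    · rw [compl_compl]; exact h3
  · exact h2'.mono fun y hy => hy.2
  · intro q hq
    have := h1 q hq
    rw [hd, hd, zero_add, mul_comm] at this
    rw [ENNReal.ofReal_div_of_pos hF, ENNReal.eq_div_iff, mul_comm, this, add_comm (∑ i, w i)]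
    · simpa using hF
    · exact ENNReal.ofReal_ne_top

/-- **Theorem 6.7** (singularity of conditional copulas). Let `C` be a `d`-dimensional
Archimedean copula with strict generator `ψ` (its measure `μ` characterized by
`μ([0,v]) = ψ(Σᵢφ(vᵢ))`). If `μ_C` is singular w.r.t. `λ_d`, then for every
`ℓ ∈ {1,…,d-2}` there is a set `Λ ∈ B([0,1]^ℓ)` (contained in `(0,1)^ℓ`) with
`λ_ℓ(Λ) = 1` such that for every `x ∈ Λ` the conditional copula `Cˣ` (its measure `νx`
characterized by `νx([0,u]) = Cˣ(u)`) is singular w.r.t. `λ_{d-ℓ}`. -/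
theorem conditional_copula_singular
    (d : ℕ) (hd : 2 ≤ d)
    (ψ φ : ℝ → ℝ) (hgen : IsStrictGenerator d ψ φ)
    (μ : Measure (Fin d → ℝ)) (hμp : IsProbabilityMeasure μ)
    (hμc : μ (unitCube d) = 1)
    (hμ : ∀ v : Fin d → ℝ, (∀ i, v i ∈ Ioc (0:ℝ) 1) →
      μ (lowerBox v) = ENNReal.ofReal (ψ (∑ i, φ (v i))))
    (hsing : μ ⟂ₘ (volume : Measure (Fin d → ℝ))) :
    ∀ l : ℕ, 1 ≤ l → l ≤ d - 2 →
      ∃ Λ : Set (Fin l → ℝ), MeasurableSet Λ ∧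
        Λ ⊆ {x | ∀ i, x i ∈ Ioo (0:ℝ) 1} ∧ volume Λ = 1 ∧
        ∀ x ∈ Λ, ∀ νx : Measure (Fin (d - l) → ℝ), IsProbabilityMeasure νx →
          νx (unitCube (d - l)) = 1 →
          (∀ u : Fin (d - l) → ℝ, (∀ j, u j ∈ Ioc (0:ℝ) 1) →
            νx (lowerBox u) = ENNReal.ofReal (condCop ψ φ x u)) →
          νx ⟂ₘ (volume : Measure (Fin (d - l) → ℝ)) := by
  intro l hl1 hl2
  generalize hm : d - l = m
  obtain rfl : d = l + m := by omega
  obtain ⟨j, rfl⟩ : ∃ j, l = j + 1 := ⟨l - 1, by omega⟩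
  have hG := gen_psi hgen
  have hφ : ∀ u ∈ Ioc (0:ℝ) 1, pseudoInv ψ u = φ u := by
    intro u hu
    obtain ⟨z, hz, rfl⟩ := hG.exists_inv hu
    rw [hG.inv_eta hz, hgen.2.2 z hz]
  have hμ' : ∀ u : Fin (j+1+m) → ℝ, (∀ i, u i ∈ Ioc (0:ℝ) 1) →
      μ (lowerBox u) = ENNReal.ofReal (ψ (∑ i, pseudoInv ψ (u i))) := by
    intro u hu
    rw [hμ u hu]
    congr 2
    exact Finset.sum_congr rfl fun i _ => (hφ _ (hu i)).symm
  have hpos := hG.map_pos μ hμc hμ'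
  have hI := hG.map_Ici μ hμc hμ'
  have hconc := hG.conc μ hμc hμ'
  set ρ := μ.map (fun (u : Fin (j+1+m) → ℝ) i => pseudoInv ψ (u i)) with hρ
  have hρp : IsProbabilityMeasure ρ :=
    Measure.isProbabilityMeasure_map (hG.measurable_invc _).aemeasurable
  have hρs : ρ ⟂ₘ volume := by
    obtain ⟨N, hNm, hN1, hN2⟩ := hsing
    have h0 := hG.null_up hN2
    obtain ⟨T, hT, hTm, hT0⟩ := exists_measurable_superset_of_null h0
    refine ⟨Tᶜ, hTm.compl, ?_, by rwa [compl_compl]⟩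
    rw [hρ, Measure.map_apply (hG.measurable_invc _) hTm.compl, measure_eq_zero_iff_ae_notMem]
    filter_upwards [measure_eq_zero_iff_ae_notMem.1 hN1, hconc] with u hu hc
    simp only [mem_preimage, mem_compl_iff, not_not]
    refine hT ⟨fun i => hG.inv_pos (hc i), ?_⟩
    have : (fun i => ψ (pseudoInv ψ (u i))) = u :=
      funext fun i => hG.eta_inv ⟨(hc i).1, (hc i).2.le⟩
    rw [mem_compl_iff]
    rw [this]
    exact hu
  have hcore := core (by omega) hgen ρ hρs hpos hI
  obtain ⟨T, hT, hTm, hT0⟩ := exists_measurable_superset_of_null (hG.null_down (ae_iff.1 hcore))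
  have hcube : MeasurableSet {x : Fin (j+1) → ℝ | ∀ i, x i ∈ Ioo (0:ℝ) 1} := by measurability
  refine ⟨{x | ∀ i, x i ∈ Ioo (0:ℝ) 1} \ T, hcube.diff hTm, sdiff_subset, ?_, ?_⟩
  · rw [measure_sdiff_null hT0]
    have : {x : Fin (j+1) → ℝ | ∀ i, x i ∈ Ioo (0:ℝ) 1} = Set.univ.pi fun _ => Ioo (0:ℝ) 1 := by
      ext x; simp
    rw [this, volume_pi_pi]
    simp
  · rintro x ⟨hx, hxT⟩ νx hνp hνc hν
    have hw : (fun i => pseudoInv ψ (x i)) ∈ posCone (j+1) := fun i => hG.inv_pos (hx i)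
    have hgood := not_not.1 fun hn => hxT (hT ⟨hx, hn⟩)
    obtain ⟨κ, hκp, hκs, hκpos, hκI⟩ := hgood hw
    have hsum : ∑ i, pseudoInv ψ (x i) = ∑ i, φ (x i) :=
      Finset.sum_congr rfl fun i _ => hφ _ ⟨(hx i).1, (hx i).2.le⟩
    have hs : 0 < ∑ i, φ (x i) := by
      rw [← hsum]; exact Finset.sum_pos (fun i _ => hw i) Finset.univ_nonempty
    have hX := gen_psiX hgen hl2 x hs
    have hν' : ∀ u : Fin m → ℝ, (∀ i, u i ∈ Ioc (0:ℝ) 1) →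
        νx (lowerBox u) = ENNReal.ofReal (psiX ψ φ x (∑ i, pseudoInv (psiX ψ φ x) (u i))) := by
      intro u hu
      rw [hν u hu, condCop, if_neg]
      rintro ⟨i, hi⟩
      exact absurd (hu i).1 (not_lt.2 hi)
    have hconcX := hX.conc νx hνc hν'
    have hmapp : IsProbabilityMeasure (νx.map (fun u i => pseudoInv (psiX ψ φ x) (u i))) :=
      Measure.isProbabilityMeasure_map (hX.measurable_invc _).aemeasurable
    have heq : νx.map (fun u i => pseudoInv (psiX ψ φ x) (u i)) = κ := by
      refine ext_Ici _ _ (hX.map_pos νx hνc hν') hκpos fun q hq => ?_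
      rw [hX.map_Ici νx hνc hν' _ (fun i => by exact_mod_cast hq i), hκI q hq, psiX_eq, hsum]
    obtain ⟨N, hNm, hN1, hN2⟩ := hκs
    obtain ⟨R, hR, hRm, hR0⟩ := exists_measurable_superset_of_null (hX.null_down hN2)
    refine ⟨Rᶜ, hRm.compl, ?_, by rwa [compl_compl]⟩
    rw [← heq, Measure.map_apply (hX.measurable_invc _) hNm] at hN1
    rw [measure_eq_zero_iff_ae_notMem]
    filter_upwards [measure_eq_zero_iff_ae_notMem.1 hN1, hconcX] with u hu hc
    simp only [mem_compl_iff, not_not]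
    exact hR ⟨hc, hu⟩
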